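/- Under the forward Euler scheme f_{n+1}(v_i) = f_n(v_i) + tau * Δ_v^p f_n(v_i), the weighted mean sum_{v in V} w_I(v)^alpha f_n(v) is conserved, i.e. sum_v w_I(v)^alpha f_{n+1}(v) = sum_v w_I(v)^alpha f_n(v), provided the weight condition w_I(v_k)^alpha w_G(v_k)^epsilon = w_I(v_j)^alpha w_G(v_j)^eta holds for all v_j in a_out and v_k in a_in of every hyperarc a. -/

import Mathlib

open Finset

/-- Vertex gradient without the hyperarc-weight factor. -/
noncomputable def ngrad {V : Type*} [Fintype V] [DecidableEq V]
    (wI wG : V → ℝ) (α ε η : ℝ) (f : V → ℝ) (a : Finset V × Finset V) : ℝ :=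
  ∑ v : V,
    ((if v ∈ a.2 then wI v ^ α * wG v ^ ε / (a.2.card : ℝ) else 0) -
     (if v ∈ a.1 then wI v ^ α * wG v ^ η / (a.1.card : ℝ) else 0)) * f v

/-- Hypergraph vertex gradient. -/
noncomputable def hgrad {V : Type*} [Fintype V] [DecidableEq V]
    (wI wG : V → ℝ) (WGa : Finset V × Finset V → ℝ)
    (α γ ε η : ℝ) (f : V → ℝ) (a : Finset V × Finset V) : ℝ :=
  WGa a ^ γ * ngrad wI wG α ε η f a

/-- Hypergraph vertex adjoint. -/
noncomputable def hadj {V : Type*} [Fintype V] [DecidableEq V]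
    (wG : V → ℝ) (WI WGa : Finset V × Finset V → ℝ)
    (β γ ε η : ℝ) (A : Finset (Finset V × Finset V))
    (F : Finset V × Finset V → ℝ) (v : V) : ℝ :=
  ∑ a ∈ A,
    ((if v ∈ a.2 then wG v ^ ε / (a.2.card : ℝ) else 0) -
     (if v ∈ a.1 then wG v ^ η / (a.1.card : ℝ) else 0)) * WI a ^ β * WGa a ^ γ * F a

/-- Hypergraph vertex divergence. -/
noncomputable def hdiv {V : Type*} [Fintype V] [DecidableEq V]
    (wG : V → ℝ) (WI WGa : Finset V × Finset V → ℝ)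
    (β γ ε η : ℝ) (A : Finset (Finset V × Finset V))
    (F : Finset V × Finset V → ℝ) (v : V) : ℝ :=
  ∑ a ∈ A,
    ((if v ∈ a.1 then wG v ^ η / (a.1.card : ℝ) else 0) -
     (if v ∈ a.2 then wG v ^ ε / (a.2.card : ℝ) else 0)) * WI a ^ β * WGa a ^ γ * F a

/-- Hypergraph vertex p-Laplacian, Δ_v^p f = div_v(|∇_v f|^{p-2} ∇_v f). -/
noncomputable def hlap {V : Type*} [Fintype V] [DecidableEq V]
    (wI wG : V → ℝ) (WI WGa : Finset V × Finset V → ℝ)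
    (α β γ ε η p : ℝ) (A : Finset (Finset V × Finset V))
    (f : V → ℝ) (v : V) : ℝ :=
  hdiv wG WI WGa β γ ε η A
    (fun a => |hgrad wI wG WGa α γ ε η f a| ^ (p - 2) * hgrad wI wG WGa α γ ε η f a) v

/-- Hypergraph vertex 2-Laplacian, Δ_v^2 = div_v ∘ ∇_v. -/
noncomputable def hlap2 {V : Type*} [Fintype V] [DecidableEq V]
    (wI wG : V → ℝ) (WI WGa : Finset V × Finset V → ℝ)
    (α β γ ε η : ℝ) (A : Finset (Finset V × Finset V))
    (f : V → ℝ) (v : V) : ℝ :=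
  hdiv wG WI WGa β γ ε η A (hgrad wI wG WGa α γ ε η f) v

/-- The constant function `1` lies in the kernel of the vertex gradient when the vertex weights
of output and input vertices balance. -/
theorem ngrad_one_eq_zero {V : Type*} [Fintype V] [DecidableEq V]
    (wI wG : V → ℝ) (α ε η : ℝ) (a : Finset V × Finset V)
    (h₁ : a.1.Nonempty) (h₂ : a.2.Nonempty)
    (hw : ∀ vj ∈ a.1, ∀ vk ∈ a.2, wI vk ^ α * wG vk ^ ε = wI vj ^ α * wG vj ^ η) :
    ngrad wI wG α ε η (fun _ => 1) a = 0 := by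
  obtain ⟨j, hj⟩ := h₁
  obtain ⟨k, hk⟩ := h₂
  have hc₁ : (a.1.card : ℝ) ≠ 0 := Nat.cast_ne_zero.mpr (Finset.card_ne_zero_of_mem hj)
  have hc₂ : (a.2.card : ℝ) ≠ 0 := Nat.cast_ne_zero.mpr (Finset.card_ne_zero_of_mem hk)
  have e₂ : ∑ v ∈ a.2, wI v ^ α * wG v ^ ε / (a.2.card : ℝ) = wI j ^ α * wG j ^ η := by
    rw [Finset.sum_congr rfl fun v hv => by rw [hw j hj v hv], Finset.sum_const, nsmul_eq_mul,
      mul_div_cancel₀ _ hc₂]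
  have e₁ : ∑ v ∈ a.1, wI v ^ α * wG v ^ η / (a.1.card : ℝ) = wI k ^ α * wG k ^ ε := by
    rw [Finset.sum_congr rfl fun v hv => by rw [← hw v hv k hk], Finset.sum_const, nsmul_eq_mul,
      mul_div_cancel₀ _ hc₁]
  simp only [ngrad, mul_one, Finset.sum_sub_distrib, Finset.sum_ite_mem, Finset.univ_inter]
  rw [e₁, e₂, hw j hj k hk, sub_self]

/-- Divergence is the negative adjoint of the gradient, tested against the constant `1`. -/
theorem sum_mul_hdiv {V : Type*} [Fintype V] [DecidableEq V]
    (wI wG : V → ℝ) (WI WGa : Finset V × Finset V → ℝ) (α β γ ε η : ℝ)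
    (A : Finset (Finset V × Finset V)) (F : Finset V × Finset V → ℝ) :
    ∑ v : V, wI v ^ α * hdiv wG WI WGa β γ ε η A F v =
      -∑ a ∈ A, WI a ^ β * hgrad wI wG WGa α γ ε η (fun _ => 1) a * F a := by
  simp only [hdiv, hgrad, ngrad, Finset.mul_sum, Finset.sum_mul, mul_one]
  rw [Finset.sum_comm, ← Finset.sum_neg_distrib]
  refine Finset.sum_congr rfl fun a _ => ?_
  rw [← Finset.sum_neg_distrib]
  refine Finset.sum_congr rfl fun v _ => ?_
  split_ifs <;> ring

/-- under the weight condition, the forward Euler scheme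
f_{n+1} = f_n + τ Δ_v^p f_n conserves the weighted mean. -/
theorem forward_euler_conserves_mean {V : Type*} [Fintype V] [DecidableEq V]
    (wI wG : V → ℝ) (WI WGa : Finset V × Finset V → ℝ) (α β γ ε η p : ℝ)
    (hp : 1 < p) (τ : ℝ) (hτ : 0 < τ)
    (A : Finset (Finset V × Finset V))
    (hwI : ∀ v, 0 < wI v) (hwG : ∀ v, 0 < wG v)
    (hWI : ∀ a, 0 < WI a) (hWGa : ∀ a, 0 < WGa a)
    (hA : ∀ a ∈ A, a.1.Nonempty ∧ a.2.Nonempty ∧ Disjoint a.1 a.2)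
    (hw : ∀ a ∈ A, ∀ vj ∈ a.1, ∀ vk ∈ a.2,
      wI vk ^ α * wG vk ^ ε = wI vj ^ α * wG vj ^ η)
    (f : V → ℝ) :
    ∑ v : V, wI v ^ α * (f v + τ * hlap wI wG WI WGa α β γ ε η p A f v) =
      ∑ v : V, wI v ^ α * f v := by
  simp only [mul_add, Finset.sum_add_distrib, mul_left_comm _ τ, ← Finset.mul_sum, hlap]
  rw [sum_mul_hdiv, add_eq_left, Finset.sum_eq_zero fun a ha => ?_, neg_zero, mul_zero]
  obtain ⟨h₁, h₂, -⟩ := hA a ha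
  rw [hgrad, ngrad_one_eq_zero wI wG α ε η a h₁ h₂ (hw a ha)]
  ring
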